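/- Let G = G_1 × ··· × G_k be a product of finite cyclic groups of orders n_1,...,n_k, let 𝒪 be a commutative ring, A a free 𝒪-module with trivial G-action, and M ∈ 𝒪 a common divisor of all n_i. Then for each q ≥ 0, H^q(G, A/MA) is a free A/MA-module of rank equal to the number of monomials w = g_1^{a_1}···g_k^{a_k} with a_i ≥ 0 and ∑ a_i = q. -/

import Mathlib

section CatPart

open CategoryTheory

variable {R G : Type} [CommRing R] [Group G] (S : ℕ → Type)
  (d : ∀ n, Rep.free R G (S (n + 1)) ⟶ Rep.free R G (S n))
  (ε : Rep.free R G (S 0) ⟶ Rep.trivial R G R)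

noncomputable def resCx (hdd : ∀ n, d (n + 1) ≫ d n = 0) : ChainComplex (Rep R G) ℕ :=
  ChainComplex.of (fun n => Rep.free R G (S n)) d hdd

lemma resCx_d (hdd : ∀ n, d (n + 1) ≫ d n = 0) (n : ℕ) :
    (resCx S d hdd).d (n + 1) n = d n := by
  simp [resCx]

noncomputable def resπ (hdd : ∀ n, d (n + 1) ≫ d n = 0) (hε : d 0 ≫ ε = 0) :
    resCx S d hdd ⟶ (ChainComplex.single₀ (Rep R G)).obj (Rep.trivial R G R) :=
  ((resCx S d hdd).toSingle₀Equiv _).symm ⟨ε, by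
    have : (resCx S d hdd).d 1 0 = d 0 := resCx_d S d hdd 0
    rw [this]; exact hε⟩

lemma resπ_quasiIso (hdd : ∀ n, d (n + 1) ≫ d n = 0) (hε : d 0 ≫ ε = 0)
    (hex : ∀ n x, (d n).hom x = 0 → ∃ y, (d (n + 1)).hom y = x)
    (hex0 : ∀ x, ε.hom x = 0 → ∃ y, (d 0).hom y = x)
    (hsurj : Function.Surjective ε.hom) : QuasiIso (resπ S d ε hdd hε) where
  quasiIsoAt m := by
    have hd : ∀ n, (resCx S d hdd).d (n + 1) n = d n := resCx_d S d hdd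
    cases m with
    | zero =>
      rw [ChainComplex.quasiIsoAt₀_iff, ShortComplex.quasiIso_iff_of_zeros' _ rfl rfl rfl]
      constructor
      · apply (forget₂ _ (ModuleCat R)).reflects_exact_of_faithful
        rw [ShortComplex.moduleCat_exact_iff]
        intro x hx
        obtain ⟨y, hy⟩ := hex0 x (by
          simpa [resπ, ChainComplex.toSingle₀Equiv] using! hx)
        refine ⟨y, ?_⟩
        rw [← hy, ← hd]
        rfl
      · rw [Rep.epi_iff_surjective]
        simpa [resπ, ChainComplex.toSingle₀Equiv] using! hsurj
    | succ m =>
      rw [quasiIsoAt_iff_exactAt' (hL := ChainComplex.exactAt_succ_single_obj ..),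
          HomologicalComplex.exactAt_iff' _ (m + 2) (m + 1) m (by simp) (by simp)]
      apply (forget₂ _ (ModuleCat R)).reflects_exact_of_faithful
      rw [ShortComplex.moduleCat_exact_iff]
      intro x hx
      obtain ⟨y, hy⟩ := hex m x (by
        rw [← hd]; exact hx)
      refine ⟨y, ?_⟩
      rw [← hy, ← hd]
      rfl

noncomputable def resRes (hdd : ∀ n, d (n + 1) ≫ d n = 0) (hε : d 0 ≫ ε = 0)
    (hex : ∀ n x, (d n).hom x = 0 → ∃ y, (d (n + 1)).hom y = x)
    (hex0 : ∀ x, ε.hom x = 0 → ∃ y, (d 0).hom y = x)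
    (hsurj : Function.Surjective ε.hom) : ProjectiveResolution (Rep.trivial R G R) where
  complex := resCx S d hdd
  projective n := inferInstanceAs (Projective (Rep.free R G (S n)))
  π := resπ S d ε hdd hε
  quasiIso := resπ_quasiIso S d ε hdd hε hex hex0 hsurj

lemma cohomology_of_minimal (hdd : ∀ n, d (n + 1) ≫ d n = 0) (hε : d 0 ≫ ε = 0)
    (hex : ∀ n x, (d n).hom x = 0 → ∃ y, (d (n + 1)).hom y = x)
    (hex0 : ∀ x, ε.hom x = 0 → ∃ y, (d 0).hom y = x)
    (hsurj : Function.Surjective ε.hom) (B : Rep R G)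
    (hB : ∀ n (f : Rep.free R G (S n) ⟶ B), d n ≫ f = 0) (q : ℕ) :
    Nonempty (groupCohomology B q ≃ₗ[R] (S q → B)) := by
  let P := resRes S d ε hdd hε hex hex0 hsurj
  have hd : ∀ n, (resCx S d hdd).d (n + 1) n = d n := resCx_d S d hdd
  have hz : ∀ i j, (P.complex.linearYonedaObj R B).d i j = 0 := by
    intro i j
    by_cases hij : i + 1 = j
    · subst hij
      ext f
      have h := hB i f
      rw [← hd] at h
      simpa using! h
    · exact HomologicalComplex.shape _ _ _ (by simpa using hij)
  have e1 := groupCohomologyIso B q P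
  have e2 := (ShortComplex.HomologyData.ofZeros ((P.complex.linearYonedaObj R B).sc q)
    (hz _ _) (hz _ _)).left.homologyIso
  have e3 : (P.complex.linearYonedaObj R B).X q ≃ₗ[R] (S q → B) :=
    Rep.freeLiftLEquiv R G (S q) B
  exact ⟨(e1 ≪≫ e2).toLinearEquiv.trans e3⟩

end CatPart

section AbsPart

/-- Abstract data for the tensor product of contractible complexes, inside a ring. -/
structure OpData (E : Type) [Ring E] where
  d : ℕ → E
  h : ℕ → E
  p : ℕ → E
  t : ℕ → E
  dd : ∀ i j, i ≠ j → Commute (d i) (d j)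
  dh : ∀ i j, i ≠ j → Commute (d i) (h j)
  dp : ∀ i j, i ≠ j → Commute (d i) (p j)
  dt : ∀ i j, i ≠ j → Commute (d i) (t j)
  hp : ∀ i j, i ≠ j → Commute (h i) (p j)
  ht : ∀ i j, i ≠ j → Commute (h i) (t j)
  pp : ∀ i j, i ≠ j → Commute (p i) (p j)
  pt : ∀ i j, i ≠ j → Commute (p i) (t j)
  tt : ∀ i j, i ≠ j → Commute (t i) (t j)
  ldd : ∀ i, d i * d i = 0
  ldh : ∀ i, d i * h i + h i * d i = 1 - p i
  lpd : ∀ i, p i * d i = 0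
  ldp : ∀ i, d i * p i = 0
  ltd : ∀ i, t i * d i = - (d i * t i)
  lth : ∀ i, t i * h i = - (h i * t i)
  ltp : ∀ i, t i * p i = p i
  lpt : ∀ i, p i * t i = p i

namespace OpData

variable {E : Type} [Ring E] (O : OpData E)

def s : ℕ → E
  | 0 => 1
  | n + 1 => s n * O.t n

def Q : ℕ → E
  | 0 => 1
  | n + 1 => Q n * O.p n

def D (k : ℕ) : E := ∑ l ∈ Finset.range k, O.s l * O.d l

def H (k : ℕ) : E := ∑ l ∈ Finset.range k, O.h l * O.Q l

lemma comm_s (a : E) (n : ℕ) (ha : ∀ l < n, Commute a (O.t l)) : Commute a (O.s n) := by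
  induction n with
  | zero => exact Commute.one_right a
  | succ n ih => exact (ih fun l hl => ha l (by omega)).mul_right (ha n (by omega))

lemma comm_Q (a : E) (n : ℕ) (ha : ∀ l < n, Commute a (O.p l)) : Commute a (O.Q n) := by
  induction n with
  | zero => exact Commute.one_right a
  | succ n ih => exact (ih fun l hl => ha l (by omega)).mul_right (ha n (by omega))

lemma t_s (i n : ℕ) : Commute (O.t i) (O.s n) := by
  refine O.comm_s _ _ fun l _ => ?_
  by_cases h : i = l
  · subst h; exact Commute.refl _
  · exact O.tt _ _ h

lemma t_Q (i n : ℕ) : Commute (O.t i) (O.Q n) := by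
  refine O.comm_Q _ _ fun l _ => ?_
  by_cases h : i = l
  · subst h; exact (O.ltp i).trans (O.lpt i).symm
  · exact (O.pt _ _ (Ne.symm h)).symm

lemma s_s (m n : ℕ) : Commute (O.s m) (O.s n) :=
  O.comm_s _ _ fun l _ => (O.t_s l m).symm

lemma Q_s (m n : ℕ) : Commute (O.Q m) (O.s n) :=
  O.comm_s _ _ fun l _ => (O.t_Q l m).symm

lemma Q_mul_s (n : ℕ) : O.Q n * O.s n = O.Q n := by
  induction n with
  | zero => simp [s, Q]
  | succ n ih =>
    have h1 : Commute (O.p n) (O.s n) := O.comm_s _ _ fun l hl => O.pt _ _ (by omega)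
    calc O.Q n * O.p n * (O.s n * O.t n) = O.Q n * (O.p n * O.s n) * O.t n := by noncomm_ring
      _ = (O.Q n * O.s n) * (O.p n * O.t n) := by rw [h1.eq]; noncomm_ring
      _ = O.Q n * O.p n := by rw [ih, O.lpt]

lemma d_Q_comm (l n : ℕ) (h : n ≤ l) : Commute (O.d l) (O.Q n) :=
  O.comm_Q _ _ fun _ _ => O.dp _ _ (by omega)

lemma d_s_comm (l n : ℕ) (h : n ≤ l) : Commute (O.d l) (O.s n) :=
  O.comm_s _ _ fun _ _ => O.dt _ _ (by omega)

lemma h_s_comm (l n : ℕ) (h : n ≤ l) : Commute (O.h l) (O.s n) :=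
  O.comm_s _ _ fun _ _ => O.ht _ _ (by omega)

lemma Q_mul_d (l n : ℕ) (h : l < n) : O.Q n * O.d l = 0 := by
  induction n with
  | zero => omega
  | succ n ih =>
    by_cases hl : l = n
    · subst hl
      rw [Q, mul_assoc, O.lpd, mul_zero]
    · rw [Q, mul_assoc, ← (O.dp l n hl).eq, ← mul_assoc, ih (by omega), zero_mul]

lemma d_mul_Q (l n : ℕ) (h : l < n) : O.d l * O.Q n = 0 := by
  induction n with
  | zero => omega
  | succ n ih =>
    by_cases hl : l = n
    · subst hl
      rw [Q, ← mul_assoc, (O.d_Q_comm l l le_rfl).eq, mul_assoc, O.ldp, mul_zero]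
    · rw [Q, ← mul_assoc, ih (by omega), zero_mul]

lemma s_anti_d (l n : ℕ) (h : l < n) : O.s n * O.d l = - (O.d l * O.s n) := by
  induction n with
  | zero => omega
  | succ n ih =>
    by_cases hl : l = n
    · subst hl
      rw [s, mul_assoc, O.ltd, ← mul_assoc, (O.d_s_comm l l le_rfl).eq]; noncomm_ring
    · rw [s, mul_assoc, ← (O.dt l n hl).eq, ← mul_assoc, ih (by omega)]; noncomm_ring

lemma s_anti_h (l n : ℕ) (h : l < n) : O.s n * O.h l = - (O.h l * O.s n) := by
  induction n with
  | zero => omega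
  | succ n ih =>
    by_cases hl : l = n
    · subst hl
      rw [s, mul_assoc, O.lth, ← mul_assoc, (O.h_s_comm l l le_rfl).eq]; noncomm_ring
    · rw [s, mul_assoc, ← (O.ht l n hl).eq, ← mul_assoc, ih (by omega)]; noncomm_ring

lemma D_anti (m n : ℕ) (h : m < n) :
    (O.s m * O.d m) * (O.s n * O.d n) = - ((O.s n * O.d n) * (O.s m * O.d m)) := by
  have h1 := O.s_anti_d m n h
  have h2 := (O.d_s_comm n m h.le).eq
  have h3 := (O.dd m n h.ne).eq
  have h4 := (O.s_s m n).eq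
  have h1' : O.d m * O.s n = - (O.s n * O.d m) := by rw [h1, neg_neg]
  calc (O.s m * O.d m) * (O.s n * O.d n) = O.s m * (O.d m * O.s n) * O.d n := by noncomm_ring
    _ = - ((O.s m * O.s n) * (O.d m * O.d n)) := by rw [h1']; noncomm_ring
    _ = - (O.s n * (O.s m * O.d n) * O.d m) := by rw [h4, h3]; noncomm_ring
    _ = _ := by rw [← h2]; noncomm_ring

lemma D_sq_term (n : ℕ) : (O.s n * O.d n) * (O.s n * O.d n) = 0 := by
  have h2 := (O.d_s_comm n n le_rfl).eq
  calc (O.s n * O.d n) * (O.s n * O.d n) = O.s n * (O.d n * O.s n) * O.d n := by noncomm_ring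
    _ = O.s n * O.s n * (O.d n * O.d n) := by rw [h2]; noncomm_ring
    _ = 0 := by rw [O.ldd, mul_zero]

lemma D_sq (k : ℕ) : O.D k * O.D k = 0 := by
  induction k with
  | zero => simp [D]
  | succ k ih =>
    have hk : O.D (k + 1) = O.D k + O.s k * O.d k := Finset.sum_range_succ _ _
    have ha : O.D k * (O.s k * O.d k) = - ((O.s k * O.d k) * O.D k) := by
      rw [D, Finset.sum_mul, Finset.mul_sum, ← Finset.sum_neg_distrib]
      exact Finset.sum_congr rfl fun l hl => O.D_anti l k (Finset.mem_range.1 hl)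
    rw [hk, add_mul, mul_add, mul_add, ih, ha, O.D_sq_term]
    abel

lemma Q_mul_D (k : ℕ) : O.Q k * O.D k = 0 := by
  rw [D, Finset.mul_sum]
  refine Finset.sum_eq_zero fun l hl => ?_
  rw [← mul_assoc, (O.Q_s k l).eq, mul_assoc, O.Q_mul_d l k (Finset.mem_range.1 hl), mul_zero]

lemma DH_term (l i : ℕ) :
    (O.s l * O.d l) * (O.h i * O.Q i) + (O.h i * O.Q i) * (O.s l * O.d l) =
      if l = i then O.Q i - O.Q (i + 1) else 0 := by
  rcases lt_trichotomy l i with h | h | h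
  · rw [if_neg h.ne]
    have h1 := (O.dh l i h.ne).eq
    have h2 := O.d_mul_Q l i h
    have h3 := O.Q_mul_d l i h
    have h4 := (O.d_s_comm l l le_rfl).eq
    calc _ = O.s l * (O.d l * O.h i) * O.Q i + O.h i * (O.Q i * (O.s l * O.d l)) := by
            noncomm_ring
      _ = O.s l * O.h i * (O.d l * O.Q i) + O.h i * (O.Q i * O.d l) * O.s l := by
            rw [h1, ← h4]; noncomm_ring
      _ = 0 := by rw [h2, h3]; simp
  · subst h
    rw [if_pos rfl]
    have h1 := (O.d_s_comm l l le_rfl).eq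
    have h2 := (O.h_s_comm l l le_rfl).eq
    have h3 := O.Q_mul_s l
    have h4 := (O.Q_s l l).eq
    have h5 := (O.d_Q_comm l l le_rfl).eq
    have h6 : O.h l * O.Q l = O.Q l * O.h l :=
      (O.comm_Q _ _ fun _ _ => O.hp _ _ (by omega)).eq
    calc _ = (O.s l * O.d l) * (O.Q l * O.h l) + O.h l * (O.Q l * O.s l) * O.d l := by
            rw [h6]; rw [← h6]; noncomm_ring
      _ = O.s l * (O.d l * O.Q l) * O.h l + O.h l * O.Q l * O.d l := by
            rw [h3]; noncomm_ring
      _ = (O.Q l * O.s l) * O.d l * O.h l + (O.h l * O.Q l) * O.d l := by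
            rw [h5, h4]; noncomm_ring
      _ = O.Q l * (O.d l * O.h l + O.h l * O.d l) := by rw [h3, h6]; noncomm_ring
      _ = _ := by rw [O.ldh, Q]; noncomm_ring
  · rw [if_neg h.ne']
    have h1 := (O.dh l i h.ne').eq
    have h2 := (O.Q_s i l).eq
    have h3 := (O.d_Q_comm l i h.le).eq
    have h4 := O.s_anti_h i l h
    calc _ = O.s l * (O.d l * O.h i) * O.Q i + O.h i * (O.Q i * O.s l) * O.d l := by
            noncomm_ring
      _ = (O.s l * O.h i) * O.d l * O.Q i + O.h i * O.s l * (O.Q i * O.d l) := by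
            rw [h1, h2]; noncomm_ring
      _ = 0 := by rw [h4, ← h3]; noncomm_ring

lemma DH (k : ℕ) : O.D k * O.H k + O.H k * O.D k = 1 - O.Q k := by
  have h1 : O.D k * O.H k + O.H k * O.D k =
      ∑ i ∈ Finset.range k, ∑ l ∈ Finset.range k,
        if l = i then O.Q i - O.Q (i + 1) else 0 := by
    rw [D, H, Finset.sum_mul_sum, Finset.sum_mul_sum, Finset.sum_comm, ← Finset.sum_add_distrib]
    refine Finset.sum_congr rfl fun i _ => ?_
    rw [← Finset.sum_add_distrib]
    exact Finset.sum_congr rfl fun l _ => O.DH_term l i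
  rw [h1]
  have h2 : ∀ i ∈ Finset.range k, (∑ l ∈ Finset.range k,
        if l = i then O.Q i - O.Q (i + 1) else 0) = O.Q i - O.Q (i + 1) := by
    intro i hi
    rw [Finset.sum_ite_eq' , if_pos hi]
  rw [Finset.sum_congr rfl h2, Finset.sum_range_sub']
  rfl

end OpData
end AbsPart

section LocPart

set_option linter.unusedSectionVars false
set_option linter.unusedSimpArgs false

variable (R : Type) [CommRing R] {C : Type} [Group C] [Fintype C]

/-- local differential -/
noncomputable def dfun (c : C) : ℕ × C → (ℕ × C →₀ R)
  | (0, _) => 0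
  | (m + 1, g) => if Even m then Finsupp.single (m, g * c) 1 - Finsupp.single (m, g) 1
      else ∑ γ : C, Finsupp.single (m, γ) 1

noncomputable def hfun (c : C) (lg : C → ℕ) (x : ℕ × C) : ℕ × C →₀ R :=
  if Even x.1 then ∑ t ∈ Finset.range (lg x.2), Finsupp.single (x.1 + 1, c ^ t) 1
  else if lg x.2 + 1 = Fintype.card C then Finsupp.single (x.1 + 1, 1) 1 else 0

noncomputable def pfun (x : ℕ × C) : ℕ × C →₀ R :=
  if x.1 = 0 then Finsupp.single (0, 1) 1 else 0

noncomputable def tfun (x : ℕ × C) : ℕ × C →₀ R := Finsupp.single x ((-1) ^ x.1)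

noncomputable def dloc (c : C) : Module.End R (ℕ × C →₀ R) := Finsupp.linearCombination R (dfun R c)
noncomputable def hloc (c : C) (lg : C → ℕ) : Module.End R (ℕ × C →₀ R) :=
  Finsupp.linearCombination R (hfun R c lg)
noncomputable def ploc : Module.End R (ℕ × C →₀ R) :=
  Finsupp.linearCombination R (pfun R (C := C))
noncomputable def tloc : Module.End R (ℕ × C →₀ R) :=
  Finsupp.linearCombination R (tfun R (C := C))

variable {R}

@[simp] lemma dloc_single (c : C) (x : ℕ × C) (r : R) :
    dloc R c (Finsupp.single x r) = r • dfun R c x := by simp [dloc]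
@[simp] lemma hloc_single (c : C) (lg : C → ℕ) (x : ℕ × C) (r : R) :
    hloc R c lg (Finsupp.single x r) = r • hfun R c lg x := by simp [hloc]
@[simp] lemma ploc_single (x : ℕ × C) (r : R) :
    ploc R (Finsupp.single x r) = r • pfun R x := by simp [ploc]
@[simp] lemma tloc_single (x : ℕ × C) (r : R) :
    tloc R (Finsupp.single x r) = Finsupp.single x (r * (-1) ^ x.1) := by simp [tloc, tfun]

lemma end_ext {X V : Type} [AddCommGroup V] [Module R V] {f g : (X →₀ R) →ₗ[R] V}
    (h : ∀ x, f (Finsupp.single x 1) = g (Finsupp.single x 1)) : f = g := by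
  ext x; simpa using h x

lemma sum_mul_right_single (m : ℕ) (c : C) :
    ∑ γ : C, Finsupp.single (m, γ * c) (1 : R) = ∑ γ : C, Finsupp.single (m, γ) 1 :=
  Fintype.sum_equiv (Equiv.mulRight c) _ _ fun _ => rfl

lemma loc_dd (c : C) : dloc R c * dloc R c = 0 := by
  refine end_ext fun ⟨m, g⟩ => ?_
  rcases m with _ | _ | m
  · simp [dfun]
  · simp [dfun]
  · by_cases hm : Even m
    · have : ¬ Even (m + 1) := by simpa [Nat.even_add_one] using hm
      simp [dfun, hm, this, sum_mul_right_single]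
    · have : Even (m + 1) := by simpa [Nat.even_add_one] using hm
      simp [dfun, hm, this, sum_mul_right_single]

lemma loc_pd (c : C) : ploc R * dloc R c = 0 := by
  refine end_ext fun ⟨m, g⟩ => ?_
  rcases m with _ | _ | m
  · simp [dfun]
  · simp [dfun, pfun]
  · by_cases hm : Even (m + 1)
    · simp [dfun, hm, pfun]
    · simp [dfun, hm, pfun]

lemma loc_dp (c : C) : dloc R c * ploc R = 0 := by
  refine end_ext fun ⟨m, g⟩ => ?_
  by_cases h : m = 0 <;> simp [dfun, pfun, h]

lemma loc_tp : tloc R * ploc R = ploc R (C := C) := by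
  refine end_ext fun ⟨m, g⟩ => ?_
  by_cases h : m = 0 <;> simp [pfun, h]

lemma loc_pt : ploc R * tloc R = ploc R (C := C) := by
  refine end_ext fun ⟨m, g⟩ => ?_
  by_cases h : m = 0 <;> simp [pfun, h]

lemma loc_td (c : C) : tloc R * dloc R c = - (dloc R c * tloc R) := by
  refine end_ext fun ⟨m, g⟩ => ?_
  rcases m with _ | m
  · simp [dfun]
  · by_cases hm : Even m
    · simp [dfun, hm, hm.add_one.neg_one_pow]
    · have : Even (m + 1) := by simpa [Nat.even_add_one] using hm
      have h' := Nat.not_even_iff_odd.1 hm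
      simp [dfun, hm, this, h'.neg_one_pow]

lemma loc_th (c : C) (lg : C → ℕ) : tloc R * hloc R c lg = - (hloc R c lg * tloc R) := by
  refine end_ext fun ⟨m, g⟩ => ?_
  by_cases hm : Even m
  · simp [hfun, hm, hm.add_one.neg_one_pow]
  · have h' := Nat.not_even_iff_odd.1 hm
    have : Even (m + 1) := by simpa [Nat.even_add_one] using hm
    by_cases hc : lg g + 1 = Fintype.card C <;> simp [hfun, hm, hc, this, h'.neg_one_pow]

lemma exists_log (c : C) (hc : ∀ x, x ∈ Subgroup.zpowers c) :
    ∃ lg : C → ℕ, (∀ g, c ^ lg g = g) ∧ (∀ g, lg g < Fintype.card C) ∧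
      (∀ j < Fintype.card C, lg (c ^ j) = j) ∧ c ^ Fintype.card C = 1 := by
  have ho : orderOf c = Fintype.card C := orderOf_eq_card_of_forall_mem_zpowers hc |>.trans
    Nat.card_eq_fintype_card
  have h1 : ∀ g : C, ∃ j < Fintype.card C, c ^ j = g := by
    intro g
    obtain ⟨i, rfl⟩ := mem_powers_iff_mem_zpowers.2 (hc g)
    exact ⟨i % orderOf c, by rw [ho]; exact Nat.mod_lt _ Fintype.card_pos, pow_mod_orderOf c i⟩
  choose lg hlt hlg using h1
  refine ⟨lg, hlg, hlt, fun j hj => ?_, pow_card_eq_one⟩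
  exact pow_injOn_Iio_orderOf (by simpa [ho] using hlt _) (by simpa [ho] using hj) (hlg _)

lemma sum_univ_eq_range (m : ℕ) (c : C) (lg : C → ℕ) (h1 : ∀ g, c ^ lg g = g)
    (h2 : ∀ g, lg g < Fintype.card C) (h3 : ∀ j < Fintype.card C, lg (c ^ j) = j) :
    ∑ γ : C, Finsupp.single (m, γ) (1 : R) =
      ∑ t ∈ Finset.range (Fintype.card C), Finsupp.single (m, c ^ t) 1 := by
  refine Finset.sum_bij' (fun g _ => lg g) (fun t _ => c ^ t) ?_ ?_ ?_ ?_ ?_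
  · intro g _; simpa using h2 g
  · intro t _; simp
  · intro g _; exact h1 g
  · intro t ht; exact h3 t (Finset.mem_range.1 ht)
  · intro g _; simp [h1]

lemma loc_dh (c : C) (lg : C → ℕ) (h1 : ∀ g, c ^ lg g = g)
    (h2 : ∀ g, lg g < Fintype.card C) (h3 : ∀ j < Fintype.card C, lg (c ^ j) = j)
    (h4 : c ^ Fintype.card C = 1) :
    dloc R c * hloc R c lg + hloc R c lg * dloc R c = 1 - ploc R := by
  have hpos : 0 < Fintype.card C := Fintype.card_pos
  have hl1 : lg 1 = 0 := by simpa using h3 0 hpos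
  refine end_ext fun ⟨m, g⟩ => ?_
  by_cases hm : Even m
  · have key : dloc R c (hfun R c lg (m, g)) =
        Finsupp.single (m, g) 1 - Finsupp.single (m, 1) 1 := by
      simp only [hfun, hm, if_true, map_sum, dloc_single, dfun, one_smul, ← pow_succ]
      rw [Finset.sum_range_sub (fun t => Finsupp.single (m, c ^ t) (1 : R)), h1, pow_zero]
    rcases m with _ | m
    · simp [key, dfun, pfun]
    · have hm' : ¬ Even m := by simpa [Nat.even_add_one] using hm
      have : hloc R c lg (dfun R c (m + 1, g)) = Finsupp.single (m + 1, 1) 1 := by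
        simp only [dfun, hm', if_false]
        rw [sum_univ_eq_range m c lg h1 h2 h3, map_sum]
        rw [Finset.sum_eq_single_of_mem (Fintype.card C - 1) (by simp [hpos])]
        · simp only [hloc_single, hfun, hm', if_false, one_smul]
          rw [h3 _ (by omega), if_pos (by omega)]
        · intro b hb hb'
          have hb := Finset.mem_range.1 hb
          simp only [hloc_single, hfun, hm', if_false, one_smul]
          rw [h3 _ hb, if_neg (by omega)]
      simp [key, this, pfun]
  · rcases m with _ | m
    · simp at hm
    have hm' : Even m := by simpa [Nat.even_add_one] using hm
    have hg : g * c = c ^ (lg g + 1) := by rw [pow_succ, h1]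
    by_cases hc : lg g + 1 = Fintype.card C
    · have hgc : g * c = 1 := by rw [hg, hc, h4]
      have hs : ∑ γ : C, Finsupp.single (m + 1, γ) (1 : R) =
          ∑ t ∈ Finset.range (lg g), Finsupp.single (m + 1, c ^ t) 1 +
            Finsupp.single (m + 1, g) 1 := by
        rw [sum_univ_eq_range _ c lg h1 h2 h3, ← hc, Finset.sum_range_succ, h1]
      simp [hfun, dfun, hm, hm', hc, hgc, hl1, pfun, hs]
    · have := h2 g
      have hlt : lg (g * c) = lg g + 1 := by rw [hg, h3 _ (by omega)]
      simp [hfun, dfun, hm, hm', hc, hlt, pfun, Finset.sum_range_succ, h1]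

/-- support statements -/
lemma dfun_supp (c : C) (x y : ℕ × C) (h : y ∈ (dfun R c x).support) : y.1 + 1 = x.1 := by
  obtain ⟨m, g⟩ := x
  by_contra hne
  apply Finsupp.mem_support_iff.1 h
  rcases m with _ | m
  · simp [dfun]
  · have : ∀ γ, (m, γ) ≠ y := by rintro γ rfl; exact hne rfl
    by_cases hm : Even m <;> simp [dfun, hm, Finsupp.single_apply, this, Finsupp.finsetSum_apply]

lemma hfun_supp (c : C) (lg : C → ℕ) (x y : ℕ × C) (h : y ∈ (hfun R c lg x).support) :
    y.1 = x.1 + 1 := by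
  obtain ⟨m, g⟩ := x
  by_contra hne
  apply Finsupp.mem_support_iff.1 h
  have : ∀ γ, (m + 1, γ) ≠ y := by rintro γ rfl; exact hne rfl
  by_cases hm : Even m
  · simp [hfun, hm, Finsupp.single_apply, this, Finsupp.finsetSum_apply]
  · by_cases hc : lg g + 1 = Fintype.card C <;> simp [hfun, hm, hc, Finsupp.single_apply, this]

lemma pfun_supp (x y : ℕ × C) (h : y ∈ (pfun R x).support) : y.1 = x.1 := by
  obtain ⟨m, g⟩ := x
  by_contra hne
  apply Finsupp.mem_support_iff.1 h
  by_cases hm : m = 0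
  · have : (0, 1) ≠ y := by rintro rfl; exact hne hm.symm
    simp [pfun, hm, Finsupp.single_apply, this]
  · simp [pfun, hm]

lemma tfun_supp (x y : ℕ × C) (h : y ∈ (tfun R x).support) : y.1 = x.1 := by
  have := Finsupp.support_single_subset h
  simp at this
  rw [this]

/-- left translation -/
lemma dloc_trans (c a : C) (v : ℕ × C →₀ R) :
    dloc R c (Finsupp.mapDomain (fun x => (x.1, a * x.2)) v) =
      Finsupp.mapDomain (fun x => (x.1, a * x.2)) (dloc R c v) := by
  have : dloc R c ∘ₗ Finsupp.lmapDomain R R (fun x : ℕ × C => (x.1, a * x.2)) =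
      Finsupp.lmapDomain R R (fun x : ℕ × C => (x.1, a * x.2)) ∘ₗ dloc R c := by
    refine end_ext fun ⟨m, g⟩ => ?_
    simp only [LinearMap.comp_apply, Finsupp.lmapDomain_apply, Finsupp.mapDomain_single,
      dloc_single, one_smul]
    rcases m with _ | m
    · simp [dfun]
    · by_cases hm : Even m
      · simp only [dfun, hm, if_true, ← Finsupp.lmapDomain_apply R R, map_sub]
        simp only [Finsupp.lmapDomain_apply, Finsupp.mapDomain_single, mul_assoc]
      · simp only [dfun, hm, if_false, ← Finsupp.lmapDomain_apply R R, map_sum]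
        simp only [Finsupp.lmapDomain_apply, Finsupp.mapDomain_single]
        exact (Fintype.sum_equiv (Equiv.mulLeft a) _ _ fun _ => rfl).symm
  exact LinearMap.congr_fun this v

lemma tloc_trans (a : C) (v : ℕ × C →₀ R) :
    tloc R (Finsupp.mapDomain (fun x => (x.1, a * x.2)) v) =
      Finsupp.mapDomain (fun x => (x.1, a * x.2)) (tloc R v) := by
  have : tloc R ∘ₗ Finsupp.lmapDomain R R (fun x : ℕ × C => (x.1, a * x.2)) =
      Finsupp.lmapDomain R R (fun x : ℕ × C => (x.1, a * x.2)) ∘ₗ tloc R := by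
    refine end_ext fun ⟨m, g⟩ => ?_
    simp
  exact LinearMap.congr_fun this v

end LocPart
section LiftPart

set_option linter.unusedSectionVars false
set_option linter.unusedSimpArgs false

variable {R : Type} [CommRing R] {k : ℕ} {X : Fin k → Type}

open Function (update)

/-- Extend an operator on the `i`-th factor to the product. -/
noncomputable def lft (i : Fin k) (T : Module.End R (X i →₀ R)) :
    Module.End R ((∀ i, X i) →₀ R) :=
  Finsupp.linearCombination R fun x =>
    Finsupp.mapDomain (update x i) (T (Finsupp.single (x i) 1))

lemma lft_single (i : Fin k) (T : Module.End R (X i →₀ R)) (x : ∀ i, X i) :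
    lft i T (Finsupp.single x 1) = Finsupp.mapDomain (update x i) (T (Finsupp.single (x i) 1)) := by
  simp [lft]

lemma lft_mapDomain (i : Fin k) (T : Module.End R (X i →₀ R)) (x : ∀ i, X i) (v : X i →₀ R) :
    lft i T (Finsupp.mapDomain (update x i) v) = Finsupp.mapDomain (update x i) (T v) := by
  have : lft i T ∘ₗ Finsupp.lmapDomain R R (update x i) =
      Finsupp.lmapDomain R R (update x i) ∘ₗ T := by
    refine end_ext fun y => ?_
    simp only [LinearMap.comp_apply, Finsupp.lmapDomain_apply, Finsupp.mapDomain_single,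
      lft_single]
    congr 1
    · funext z; simp
    · simp
  exact LinearMap.congr_fun this v

lemma lft_mul (i : Fin k) (T S : Module.End R (X i →₀ R)) :
    lft i (T * S) = lft i T * lft i S := by
  refine end_ext fun x => ?_
  rw [Module.End.mul_apply, lft_single, lft_single, lft_mapDomain]
  rfl

lemma lft_add (i : Fin k) (T S : Module.End R (X i →₀ R)) :
    lft i (T + S) = lft i T + lft i S := by
  refine end_ext fun x => ?_
  rw [LinearMap.add_apply, lft_single, lft_single, lft_single, LinearMap.add_apply,
    Finsupp.mapDomain_add]

lemma lft_one (i : Fin k) : lft i (1 : Module.End R (X i →₀ R)) = 1 := by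
  refine end_ext fun x => ?_
  rw [lft_single]
  simp [Finsupp.mapDomain_single]

lemma lft_zero (i : Fin k) : lft i (0 : Module.End R (X i →₀ R)) = 0 := by
  refine end_ext fun x => ?_
  rw [lft_single]
  simp

lemma lft_neg (i : Fin k) (T : Module.End R (X i →₀ R)) : lft i (-T) = - lft i T := by
  refine end_ext fun x => ?_
  rw [LinearMap.neg_apply, lft_single, lft_single, LinearMap.neg_apply,
    ← Finsupp.lmapDomain_apply R R, map_neg, Finsupp.lmapDomain_apply]

lemma lft_sub (i : Fin k) (T S : Module.End R (X i →₀ R)) :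
    lft i (T - S) = lft i T - lft i S := by
  refine end_ext fun x => ?_
  rw [LinearMap.sub_apply, lft_single, lft_single, lft_single, LinearMap.sub_apply,
    ← Finsupp.lmapDomain_apply R R, map_sub, Finsupp.lmapDomain_apply, Finsupp.lmapDomain_apply]

lemma lft_comm_aux (i j : Fin k) (hij : i ≠ j) (T : Module.End R (X i →₀ R)) (x : ∀ i, X i)
    (v : X j →₀ R) :
    lft i T (Finsupp.mapDomain (update x j) v) =
      Finsupp.linearCombination R (fun y => Finsupp.mapDomain (update (update x j y) i)
        (T (Finsupp.single (x i) 1))) v := by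
  have : lft i T ∘ₗ Finsupp.lmapDomain R R (update x j) =
      Finsupp.linearCombination R (fun y => Finsupp.mapDomain (update (update x j y) i)
        (T (Finsupp.single (x i) 1))) := by
    refine end_ext fun y => ?_
    simp only [LinearMap.comp_apply, Finsupp.lmapDomain_apply, Finsupp.mapDomain_single,
      lft_single, Finsupp.linearCombination_single, one_smul]
    rw [Function.update_of_ne hij]
  exact LinearMap.congr_fun this v

lemma lft_comm_aux2 (i j : Fin k) (hij : i ≠ j) (x : ∀ i, X i) (v : X j →₀ R) (w : X i →₀ R) :
    Finsupp.linearCombination R (fun y => Finsupp.mapDomain (update (update x j y) i) w) v =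
    Finsupp.linearCombination R (fun z => Finsupp.mapDomain (update (update x i z) j) v) w := by
  simp only [Finsupp.linearCombination_apply, Finsupp.sum, Finsupp.mapDomain, Finset.smul_sum]
  rw [Finset.sum_comm]
  refine Finset.sum_congr rfl fun z _ => Finset.sum_congr rfl fun y _ => ?_
  rw [Function.update_comm hij]
  simp [mul_comm]

lemma lft_comm (i j : Fin k) (hij : i ≠ j) (T : Module.End R (X i →₀ R))
    (S : Module.End R (X j →₀ R)) : Commute (lft i T) (lft j S) := by
  refine end_ext fun x => ?_
  rw [Module.End.mul_apply, Module.End.mul_apply, lft_single, lft_single,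
    lft_comm_aux i j hij, lft_comm_aux j i hij.symm, lft_comm_aux2 i j hij]

/-- diagonal operators -/
noncomputable def diag {Y : Type} (c : Y → R) : Module.End R (Y →₀ R) :=
  Finsupp.linearCombination R fun x => Finsupp.single x (c x)

lemma diag_single {Y : Type} (c : Y → R) (x : Y) (r : R) :
    diag c (Finsupp.single x r) = Finsupp.single x (r * c x) := by simp [diag]

lemma diag_of_support {Y : Type} (c : Y → R) (r : R) (v : Y →₀ R) (h : ∀ y ∈ v.support, c y = r) :
    diag c v = r • v := by
  conv_rhs => rw [← Finsupp.sum_single v]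
  rw [diag, Finsupp.linearCombination_apply, Finsupp.sum, Finsupp.sum, Finset.smul_sum]
  refine Finset.sum_congr rfl fun y hy => ?_
  simp [h y hy, mul_comm]

lemma diag_lft (i : Fin k) (T : Module.End R (X i →₀ R)) (c c' : (∀ i, X i) → R)
    (h : ∀ x y, y ∈ (T (Finsupp.single (x i) 1)).support → c (update x i y) = c' x) :
    diag c * lft i T = lft i T * diag c' := by
  classical
  refine end_ext fun x => ?_
  rw [Module.End.mul_apply, Module.End.mul_apply, lft_single, diag_single, one_mul,
    ← mul_one (c' x), ← smul_eq_mul, ← Finsupp.smul_single, map_smul, lft_single]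
  apply diag_of_support
  intro y hy
  obtain ⟨z, hz, rfl⟩ := Finset.mem_image.1 (Finsupp.mapDomain_support hy)
  exact h x z hz

lemma mapDomain_lft (i : Fin k) (T : Module.End R (X i →₀ R)) (φ : ∀ i, X i → X i)
    (h : ∀ v, T (Finsupp.mapDomain (φ i) v) = Finsupp.mapDomain (φ i) (T v)) :
    Commute (Finsupp.lmapDomain R R (fun (x : ∀ i, X i) i => φ i (x i)) :
      Module.End R ((∀ i, X i) →₀ R)) (lft i T) := by
  refine end_ext fun x => ?_
  rw [Module.End.mul_apply, Module.End.mul_apply, lft_single, Finsupp.lmapDomain_apply,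
    Finsupp.lmapDomain_apply, Finsupp.mapDomain_single, lft_single, ← Finsupp.mapDomain_comp]
  rw [← Finsupp.mapDomain_single (f := φ i), h, ← Finsupp.mapDomain_comp]
  congr 1
  funext y j
  by_cases hj : j = i
  · subst hj; simp
  · simp [hj]

end LiftPart
section FinalPart

set_option linter.unusedSectionVars false
set_option linter.unusedSimpArgs false

open Function (update)

variable {R : Type} [CommRing R] {k : ℕ} {X : Fin k → Type}

noncomputable def opn (T : ∀ i : Fin k, Module.End R (X i →₀ R))
    (a : Module.End R ((∀ i, X i) →₀ R)) (i : ℕ) : Module.End R ((∀ i, X i) →₀ R) :=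
  if h : i < k then lft ⟨i, h⟩ (T ⟨i, h⟩) else a

lemma opn_lt (T : ∀ i : Fin k, Module.End R (X i →₀ R))
    (a : Module.End R ((∀ i, X i) →₀ R)) (i : ℕ) (h : i < k) :
    opn T a i = lft ⟨i, h⟩ (T ⟨i, h⟩) := dif_pos h

lemma opn_ge (T : ∀ i : Fin k, Module.End R (X i →₀ R))
    (a : Module.End R ((∀ i, X i) →₀ R)) (i : ℕ) (h : ¬ i < k) :
    opn T a i = a := dif_neg h

lemma opn_comm (T S : ∀ i : Fin k, Module.End R (X i →₀ R))
    (a b : Module.End R ((∀ i, X i) →₀ R)) (ha : ∀ e, Commute a e) (hb : ∀ e, Commute e b)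
    (i j : ℕ) (hij : i ≠ j) : Commute (opn T a i) (opn S b j) := by
  by_cases hi : i < k
  · by_cases hj : j < k
    · rw [opn_lt _ _ _ hi, opn_lt _ _ _ hj]
      exact lft_comm _ _ (by simpa using hij) _ _
    · rw [opn_ge _ _ j hj]; exact hb _
  · rw [opn_ge _ _ i hi]; exact ha _

variable {G : Fin k → Type} [∀ i, Group (G i)] [∀ i, Fintype (G i)]

/-- degree of a basis element -/
def dg (x : ∀ i, ℕ × G i) : ℕ := ∑ i, (x i).1

lemma dg_update (x : ∀ i, ℕ × G i) (i : Fin k) (y : ℕ × G i) :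
    dg (update x i y) + (x i).1 = dg x + y.1 := by
  classical
  have h1 := Finset.add_sum_erase Finset.univ (fun j => (x j).1) (Finset.mem_univ i)
  have h2 := Finset.add_sum_erase Finset.univ (fun j => (update x i y j).1) (Finset.mem_univ i)
  have h3 : ∑ j ∈ Finset.univ.erase i, (update x i y j).1 =
      ∑ j ∈ Finset.univ.erase i, (x j).1 := by
    refine Finset.sum_congr rfl fun j hj => ?_
    rw [Function.update_of_ne (Finset.ne_of_mem_erase hj)]
  simp only [Function.update_self] at h2
  unfold dg
  omega

variable (R) in
noncomputable def pr (n : ℕ) : Module.End R ((∀ i, ℕ × G i) →₀ R) :=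
  diag fun x => if dg x = n then 1 else 0

variable (R) in
/-- The action on the big module. -/
noncomputable def act (g : ∀ i, G i) : Module.End R ((∀ i, ℕ × G i) →₀ R) :=
  Finsupp.lmapDomain R R (fun (x : ∀ i, ℕ × G i) i => ((x i).1, g i * (x i).2))

variable (R) in
noncomputable def opd (c : ∀ i, G i) (lg : ∀ i, G i → ℕ) (h1 : ∀ i g, c i ^ lg i g = g)
    (h2 : ∀ i g, lg i g < Fintype.card (G i))
    (h3 : ∀ i, ∀ j < Fintype.card (G i), lg i (c i ^ j) = j)
    (h4 : ∀ i, c i ^ Fintype.card (G i) = 1) :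
    OpData (Module.End R ((∀ i, ℕ × G i) →₀ R)) where
  d := opn (fun i => dloc R (c i)) 0
  h := opn (fun i => hloc R (c i) (lg i)) 0
  p := opn (fun _ => ploc R) 1
  t := opn (fun _ => tloc R) 1
  dd := opn_comm _ _ _ _ Commute.zero_left Commute.zero_right
  dh := opn_comm _ _ _ _ Commute.zero_left Commute.zero_right
  dp := opn_comm _ _ _ _ Commute.zero_left Commute.one_right
  dt := opn_comm _ _ _ _ Commute.zero_left Commute.one_right
  hp := opn_comm _ _ _ _ Commute.zero_left Commute.one_right
  ht := opn_comm _ _ _ _ Commute.zero_left Commute.one_right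
  pp := opn_comm _ _ _ _ Commute.one_left Commute.one_right
  pt := opn_comm _ _ _ _ Commute.one_left Commute.one_right
  tt := opn_comm _ _ _ _ Commute.one_left Commute.one_right
  ldd i := by
    by_cases h : i < k
    · simp only [opn, h, dif_pos]; rw [← lft_mul, loc_dd, lft_zero]
    · simp [opn, h]
  ldh i := by
    by_cases h : i < k
    · simp only [opn, h, dif_pos]
      rw [← lft_mul, ← lft_mul, ← lft_add, loc_dh _ _ (h1 _) (h2 _) (h3 _) (h4 _)]
      exact (lft_sub _ _ _).trans (by rw [lft_one])
    · simp [opn, h]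
  lpd i := by
    by_cases h : i < k
    · simp only [opn, h, dif_pos]; rw [← lft_mul, loc_pd, lft_zero]
    · simp [opn, h]
  ldp i := by
    by_cases h : i < k
    · simp only [opn, h, dif_pos]; rw [← lft_mul, loc_dp, lft_zero]
    · simp [opn, h]
  ltd i := by
    by_cases h : i < k
    · simp only [opn, h, dif_pos]; rw [← lft_mul, ← lft_mul, loc_td]; exact lft_neg _ _
    · simp only [opn, h, dif_neg, not_false_eq_true, zero_mul, mul_zero]; exact LinearMap.ext fun v => by simp
  lth i := by
    by_cases h : i < k
    · simp only [opn, h, dif_pos]; rw [← lft_mul, ← lft_mul, loc_th]; exact lft_neg _ _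
    · simp only [opn, h, dif_neg, not_false_eq_true, zero_mul, mul_zero]; exact LinearMap.ext fun v => by simp
  ltp i := by
    by_cases h : i < k
    · simp only [opn, h, dif_pos]; rw [← lft_mul, loc_tp]
    · simp [opn, h]
  lpt i := by
    by_cases h : i < k
    · simp only [opn, h, dif_pos]; rw [← lft_mul, loc_pt]
    · simp [opn, h]

variable (c : ∀ i, G i) (lg : ∀ i, G i → ℕ) (h1 : ∀ i g, c i ^ lg i g = g)
    (h2 : ∀ i g, lg i g < Fintype.card (G i))
    (h3 : ∀ i, ∀ j < Fintype.card (G i), lg i (c i ^ j) = j)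
    (h4 : ∀ i, c i ^ Fintype.card (G i) = 1)

lemma opd_d : (opd R c lg h1 h2 h3 h4).d = opn (fun i => dloc R (c i)) 0 := rfl
lemma opd_h : (opd R c lg h1 h2 h3 h4).h = opn (fun i => hloc R (c i) (lg i)) 0 := rfl
lemma opd_p : (opd R c lg h1 h2 h3 h4).p = opn (fun _ => ploc R) 1 := rfl
lemma opd_t : (opd R c lg h1 h2 h3 h4).t = opn (fun _ => tloc R) 1 := rfl

lemma pr_t (n i : ℕ) : Commute (pr R n) ((opd R c lg h1 h2 h3 h4).t i) := by
  rw [opd_t]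
  by_cases h : i < k
  · rw [opn_lt _ _ _ h]
    refine diag_lft _ _ _ _ fun x y hy => ?_
    have := tfun_supp (R := R) (x ⟨i, h⟩) y (by simpa [tfun] using hy)
    have := dg_update x ⟨i, h⟩ y
    rw [show dg (update x ⟨i, h⟩ y) = dg x by omega]
  · rw [opn_ge _ _ _ h]; exact Commute.one_right _

lemma pr_p (n i : ℕ) : Commute (pr R n) ((opd R c lg h1 h2 h3 h4).p i) := by
  rw [opd_p]
  by_cases h : i < k
  · rw [opn_lt _ _ _ h]
    refine diag_lft _ _ _ _ fun x y hy => ?_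
    have := pfun_supp (R := R) (x ⟨i, h⟩) y (by simpa using hy)
    have := dg_update x ⟨i, h⟩ y
    rw [show dg (update x ⟨i, h⟩ y) = dg x by omega]
  · rw [opn_ge _ _ _ h]; exact Commute.one_right _

lemma pr_d (n i : ℕ) : pr R n * (opd R c lg h1 h2 h3 h4).d i =
    (opd R c lg h1 h2 h3 h4).d i * pr R (n + 1) := by
  rw [opd_d]
  by_cases h : i < k
  · rw [opn_lt _ _ _ h]
    refine diag_lft _ _ _ _ fun x y hy => ?_
    have := dfun_supp (R := R) _ (x ⟨i, h⟩) y (by simpa using hy)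
    have := dg_update x ⟨i, h⟩ y
    rw [show dg x = dg (update x ⟨i, h⟩ y) + 1 by omega]
    simp
  · rw [opn_ge _ _ _ h, mul_zero, zero_mul]

lemma pr_h (n i : ℕ) : pr R (n + 1) * (opd R c lg h1 h2 h3 h4).h i =
    (opd R c lg h1 h2 h3 h4).h i * pr R n := by
  rw [opd_h]
  by_cases h : i < k
  · rw [opn_lt _ _ _ h]
    refine diag_lft _ _ _ _ fun x y hy => ?_
    have := hfun_supp (R := R) _ _ (x ⟨i, h⟩) y (by simpa using hy)
    have := dg_update x ⟨i, h⟩ y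
    rw [show dg (update x ⟨i, h⟩ y) = dg x + 1 by omega]
    simp
  · rw [opn_ge _ _ _ h, mul_zero, zero_mul]

lemma pr_D (n : ℕ) : pr R n * (opd R c lg h1 h2 h3 h4).D k =
    (opd R c lg h1 h2 h3 h4).D k * pr R (n + 1) := by
  rw [OpData.D, Finset.mul_sum, Finset.sum_mul]
  refine Finset.sum_congr rfl fun l _ => ?_
  have := (opd R c lg h1 h2 h3 h4).comm_s (pr R n) l fun i _ => pr_t c lg h1 h2 h3 h4 n i
  rw [← mul_assoc, this.eq, mul_assoc, pr_d, mul_assoc]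

lemma pr_H (n : ℕ) : pr R (n + 1) * (opd R c lg h1 h2 h3 h4).H k =
    (opd R c lg h1 h2 h3 h4).H k * pr R n := by
  rw [OpData.H, Finset.mul_sum, Finset.sum_mul]
  refine Finset.sum_congr rfl fun l _ => ?_
  have := (opd R c lg h1 h2 h3 h4).comm_Q (pr R n) l fun i _ => pr_p c lg h1 h2 h3 h4 n i
  rw [← mul_assoc, pr_h, mul_assoc, this.eq, mul_assoc]

lemma act_D (g : ∀ i, G i) : Commute (act R g) ((opd R c lg h1 h2 h3 h4).D k) := by
  refine Commute.sum_right _ _ _ fun l _ => Commute.mul_right ?_ ?_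
  · refine OpData.comm_s _ _ _ fun i _ => ?_
    rw [opd_t]
    by_cases h : i < k
    · rw [opn_lt _ _ _ h]
      exact mapDomain_lft _ _ (fun i (x : ℕ × G i) => (x.1, g i * x.2))
        fun v => tloc_trans _ v
    · rw [opn_ge _ _ _ h]; exact Commute.one_right _
  · rw [opd_d]
    by_cases h : l < k
    · rw [opn_lt _ _ _ h]
      exact mapDomain_lft _ _ (fun i (x : ℕ × G i) => (x.1, g i * x.2))
        fun v => dloc_trans _ _ v
    · rw [opn_ge _ _ _ h]; exact Commute.zero_right _

/-- augmentation -/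
noncomputable def aug : ((∀ i, ℕ × G i) →₀ R) →ₗ[R] R :=
  Finsupp.linearCombination R fun x => if ∀ i, (x i).1 = 0 then 1 else 0

lemma aug_single (x : ∀ i, ℕ × G i) (r : R) :
    aug (Finsupp.single x r) = if ∀ i, (x i).1 = 0 then r else 0 := by
  simp [aug]

lemma Q_single (n : ℕ) (hn : n ≤ k) (x : ∀ i, ℕ × G i) :
    (opd R c lg h1 h2 h3 h4).Q n (Finsupp.single x 1) =
      if ∀ i : Fin k, i.1 < n → (x i).1 = 0 then
        Finsupp.single (fun i => if i.1 < n then (0, 1) else x i) 1 else 0 := by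
  induction n generalizing x with
  | zero => simp [OpData.Q]
  | succ n ih =>
    have hn' : n < k := hn
    rw [OpData.Q, Module.End.mul_apply]
    have hp : (opd R c lg h1 h2 h3 h4).p n = lft ⟨n, hn'⟩ (ploc R) := by
      rw [opd_p, opn_lt _ _ _ hn']
    rw [hp, lft_single, ploc_single, one_smul, pfun]
    by_cases hx : (x ⟨n, hn'⟩).1 = 0
    · rw [if_pos hx, Finsupp.mapDomain_single, ih (by omega)]
      have e1 : (∀ i : Fin k, i.1 < n → (update x ⟨n, hn'⟩ (0, 1) i).1 = 0) ↔
          (∀ i : Fin k, i.1 < n + 1 → (x i).1 = 0) := by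
        constructor
        · intro h i hi
          by_cases hin : i = ⟨n, hn'⟩
          · rw [hin, hx]
          · have := h i (by have : i.1 ≠ n := fun h => hin (Fin.ext h)
                            omega)
            rwa [Function.update_of_ne hin] at this
        · intro h i hi
          rw [Function.update_of_ne (by rintro rfl; exact lt_irrefl _ hi)]
          exact h i (by omega)
      have e2 : (fun i : Fin k => if i.1 < n then (0, 1) else update x ⟨n, hn'⟩ (0, 1) i) =
          (fun i : Fin k => if i.1 < n + 1 then (0, 1) else x i) := by
        funext i
        by_cases hin : i = ⟨n, hn'⟩
        · subst hin; simp
        · have : i.1 ≠ n := fun h => hin (Fin.ext h)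
          rw [Function.update_of_ne hin]
          by_cases hi : i.1 < n
          · rw [if_pos hi, if_pos (by omega)]
          · rw [if_neg hi, if_neg (by omega)]
      simp only [e1, e2]
    · rw [if_neg hx, if_neg (fun h => hx (h _ (by simp)))]
      simp

lemma Q_apply (v : (∀ i, ℕ × G i) →₀ R) :
    (opd R c lg h1 h2 h3 h4).Q k v = Finsupp.single (fun _ => (0, 1)) (aug v) := by
  have : (opd R c lg h1 h2 h3 h4).Q k =
      Finsupp.lsingle (fun _ => (0, 1)) ∘ₗ aug := by
    refine end_ext fun x => ?_
    rw [Q_single _ _ _ _ _ _ _ le_rfl]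
    simp only [LinearMap.comp_apply, aug_single, Finsupp.lsingle_apply, Fin.is_lt, forall_const,
      if_true]
    split_ifs <;> simp
  rw [this]; rfl

lemma aug_D (v : (∀ i, ℕ × G i) →₀ R) : aug ((opd R c lg h1 h2 h3 h4).D k v) = 0 := by
  have h := LinearMap.congr_fun ((opd R c lg h1 h2 h3 h4).Q_mul_D k) v
  rw [Module.End.mul_apply, Q_apply] at h
  simpa using h

lemma exact_D (v : (∀ i, ℕ × G i) →₀ R) (hv : (opd R c lg h1 h2 h3 h4).D k v = 0)
    (ha : aug v = 0) :
    (opd R c lg h1 h2 h3 h4).D k ((opd R c lg h1 h2 h3 h4).H k v) = v := by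
  have h := LinearMap.congr_fun ((opd R c lg h1 h2 h3 h4).DH k) v
  rw [LinearMap.add_apply, Module.End.mul_apply, Module.End.mul_apply, hv, map_zero, add_zero] at h
  rw [h]
  refine (LinearMap.sub_apply _ _ _).trans ?_
  rw [Q_apply, ha]
  simp

lemma act_single (g : ∀ i, G i) (x : ∀ i, ℕ × G i) (r : R) :
    act R g (Finsupp.single x r) = Finsupp.single (fun i => ((x i).1, g i * (x i).2)) r := by
  simp [act]

/-- invariant functionals killed by the orders vanish on boundaries -/
lemma inv_D {B : Type} [AddCommGroup B] [Module R B] (f : ((∀ i, ℕ × G i) →₀ R) →ₗ[R] B)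
    (hf : ∀ g v, f (act R g v) = f v) (hB : ∀ i (b : B), (Fintype.card (G i) : R) • b = 0)
    (v : (∀ i, ℕ × G i) →₀ R) : f ((opd R c lg h1 h2 h3 h4).D k v) = 0 := by
  rw [OpData.D, LinearMap.sum_apply, map_sum]
  refine Finset.sum_eq_zero fun l hl => ?_
  have hlk := Finset.mem_range.1 hl
  rw [← ((opd R c lg h1 h2 h3 h4).d_s_comm l l le_rfl).eq, Module.End.mul_apply]
  generalize (opd R c lg h1 h2 h3 h4).s l v = w
  have hd : (opd R c lg h1 h2 h3 h4).d l = lft ⟨l, hlk⟩ (dloc R (c _)) := by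
    rw [opd_d, opn_lt _ _ _ hlk]
  rw [hd]
  generalize (⟨l, hlk⟩ : Fin k) = i
  have key : f ∘ₗ lft i (dloc R (c i)) = 0 := by
    refine end_ext fun x => ?_
    have hinv : ∀ m γ γ', f (Finsupp.single (update x i (m, γ)) 1) =
        f (Finsupp.single (update x i (m, γ')) 1) := by
      intro m γ γ'
      rw [← hf (update 1 i (γ' * γ⁻¹)), act_single]
      congr 3
      funext j
      by_cases hj : j = i
      · subst hj; simp
      · simp [hj]
    rw [LinearMap.comp_apply, lft_single, dloc_single, one_smul, LinearMap.zero_apply,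
      ← Finsupp.lmapDomain_apply R R]
    obtain ⟨m, g⟩ := x i
    rcases m with _ | m
    · simp [dfun]
    · by_cases hm : Even m
      · simp only [dfun, hm, if_true, map_sub, Finsupp.lmapDomain_apply, Finsupp.mapDomain_single]
        rw [hinv m _ g, sub_self]
      · simp only [dfun, hm, if_false, map_sum, Finsupp.lmapDomain_apply, Finsupp.mapDomain_single]
        rw [Finset.sum_congr rfl fun γ _ => hinv m γ 1, Finset.sum_const, Finset.card_univ,
          ← Nat.cast_smul_eq_nsmul R, hB]
  exact LinearMap.congr_fun key w

end FinalPart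

section EndPart

set_option linter.unusedSectionVars false
set_option linter.unusedSimpArgs false

open CategoryTheory

variable {R : Type} [CommRing R] {k : ℕ} {G : Fin k → Type} [∀ i, Group (G i)]
  [∀ i, Fintype (G i)]

/-- exponents of total degree `n` -/
abbrev ExpDeg (k n : ℕ) : Type := {a : Fin k → ℕ // ∑ i, a i = n}

variable (R G) in
/-- inclusion of the degree `n` part in the big module -/
noncomputable def inc (n : ℕ) :
    (ExpDeg k n →₀ MonoidAlgebra R (∀ i, G i)) →ₗ[R] ((∀ i, ℕ × G i) →₀ R) :=
  Finsupp.lsum R fun a =>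
    (Finsupp.lmapDomain R R (fun (g : ∀ i, G i) i => (a.1 i, g i))) ∘ₗ
      (MonoidAlgebra.coeffLinearEquiv R).toLinearMap

lemma inc_single (n : ℕ) (a : ExpDeg k n) (g : ∀ i, G i) (r : R) :
    inc R G n (Finsupp.single a (MonoidAlgebra.single g r)) =
      Finsupp.single (fun i => (a.1 i, g i)) r := by
  simp only [inc, Finsupp.lsum_single, LinearMap.comp_apply, Finsupp.lmapDomain_apply]
  exact Finsupp.mapDomain_single

variable (R G) in
/-- projection to the degree `n` part -/
noncomputable def ret (n : ℕ) :
    ((∀ i, ℕ × G i) →₀ R) →ₗ[R] (ExpDeg k n →₀ MonoidAlgebra R (∀ i, G i)) :=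
  Finsupp.linearCombination R fun x =>
    if h : dg x = n then
      Finsupp.single ⟨fun i => (x i).1, h⟩ (MonoidAlgebra.single (fun i => (x i).2) 1) else 0

lemma ret_single (n : ℕ) (x : ∀ i, ℕ × G i) :
    ret R G n (Finsupp.single x 1) = if h : dg x = n then
      Finsupp.single ⟨fun i => (x i).1, h⟩ (MonoidAlgebra.single (fun i => (x i).2) 1) else 0 := by
  simp [ret]

lemma ret_single_pos (n : ℕ) (x : ∀ i, ℕ × G i) (h : ∑ i, (x i).1 = n) :
    ret R G n (Finsupp.single x 1) =
      Finsupp.single ⟨fun i => (x i).1, h⟩ (MonoidAlgebra.single (fun i => (x i).2) 1) :=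
  (ret_single n x).trans (dif_pos h)

lemma ret_single_neg (n : ℕ) (x : ∀ i, ℕ × G i) (h : ¬ dg x = n) :
    ret R G n (Finsupp.single x 1) = 0 :=
  (ret_single n x).trans (dif_neg h)

lemma free_ext {n : ℕ} {N : Type} [AddCommGroup N] [Module R N]
    {f f' : (ExpDeg k n →₀ MonoidAlgebra R (∀ i, G i)) →ₗ[R] N}
    (h : ∀ a g, f (Finsupp.single a (MonoidAlgebra.single g 1)) =
      f' (Finsupp.single a (MonoidAlgebra.single g 1))) : f = f' := by
  refine Finsupp.lhom_ext' fun a => MonoidAlgebra.lhom_ext' fun g => LinearMap.ext_ring ?_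
  exact h a g

lemma ret_inc (n : ℕ) (v : ExpDeg k n →₀ MonoidAlgebra R (∀ i, G i)) :
    ret R G n (inc R G n v) = v := by
  have : ret R G n ∘ₗ inc R G n = LinearMap.id := by
    refine free_ext fun a g => ?_
    rw [LinearMap.comp_apply, inc_single, ret_single_pos _ _ a.2]
    rfl
  exact LinearMap.congr_fun this v

lemma inc_ret (n : ℕ) (v : (∀ i, ℕ × G i) →₀ R) : inc R G n (ret R G n v) = pr R n v := by
  have : inc R G n ∘ₗ ret R G n = pr R n := by
    refine end_ext fun x => ?_
    rw [LinearMap.comp_apply, ret_single, pr, diag_single]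
    split_ifs with h
    · rw [inc_single, mul_one]
    · simp
  exact LinearMap.congr_fun this v

lemma pr_inc (n : ℕ) (v : ExpDeg k n →₀ MonoidAlgebra R (∀ i, G i)) :
    pr R n (inc R G n v) = inc R G n v := by
  rw [← inc_ret, ret_inc]

lemma inc_act (n : ℕ) (g : ∀ i, G i) (v : ExpDeg k n →₀ MonoidAlgebra R (∀ i, G i)) :
    inc R G n (Representation.free R (∀ i, G i) (ExpDeg k n) g v) = act R g (inc R G n v) := by
  have : inc R G n ∘ₗ Representation.free R (∀ i, G i) (ExpDeg k n) g = act R g ∘ₗ inc R G n := by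
    refine free_ext fun a γ => ?_
    rw [LinearMap.comp_apply, LinearMap.comp_apply, Representation.free_single_single, inc_single,
      inc_single, act_single]
    rfl
  exact LinearMap.congr_fun this v

lemma ret_act (n : ℕ) (g : ∀ i, G i) (v : (∀ i, ℕ × G i) →₀ R) :
    ret R G n (act R g v) = Representation.free R (∀ i, G i) (ExpDeg k n) g (ret R G n v) := by
  have : ret R G n ∘ₗ act R g = Representation.free R (∀ i, G i) (ExpDeg k n) g ∘ₗ ret R G n := by
    refine end_ext fun x => ?_
    rw [LinearMap.comp_apply, LinearMap.comp_apply, act_single]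
    by_cases h : dg x = n
    · rw [ret_single_pos n x h, ret_single_pos n (fun i => ((x i).1, g i * (x i).2)) h, Representation.free_single_single]
      rfl
    · rw [ret_single_neg n x h, ret_single_neg n (fun i => ((x i).1, g i * (x i).2)) h, map_zero]
  exact LinearMap.congr_fun this v

lemma aug_act (g : ∀ i, G i) (v : (∀ i, ℕ × G i) →₀ R) : aug (act R g v) = aug v := by
  have : aug ∘ₗ act R g = aug := by
    refine end_ext fun x => ?_
    rw [LinearMap.comp_apply, act_single, aug_single, aug_single]
  exact LinearMap.congr_fun this v

lemma aug_inc (n : ℕ) (v : ExpDeg k (n + 1) →₀ MonoidAlgebra R (∀ i, G i)) :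
    aug (inc R G (n + 1) v) = 0 := by
  have : aug ∘ₗ inc R G (n + 1) = 0 := by
    refine free_ext fun a g => ?_
    rw [LinearMap.comp_apply, inc_single, aug_single, if_neg]
    · rfl
    · intro h
      have := a.2
      rw [Finset.sum_eq_zero fun i _ => h i] at this
      omega
  exact LinearMap.congr_fun this v

variable (c : ∀ i, G i) (lg : ∀ i, G i → ℕ) (h1 : ∀ i g, c i ^ lg i g = g)
    (h2 : ∀ i g, lg i g < Fintype.card (G i))
    (h3 : ∀ i, ∀ j < Fintype.card (G i), lg i (c i ^ j) = j)
    (h4 : ∀ i, c i ^ Fintype.card (G i) = 1)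

lemma D_pr_zero : (opd R c lg h1 h2 h3 h4).D k * pr R 0 = 0 := by
  rw [OpData.D, Finset.sum_mul]
  refine Finset.sum_eq_zero fun l _ => ?_
  rw [mul_assoc]
  have : (opd R c lg h1 h2 h3 h4).d l * pr R 0 = 0 := by
    rw [opd_d]
    by_cases h : l < k
    · rw [opn_lt _ _ _ h]
      refine (diag_lft ⟨l, h⟩ _ (fun _ => 0) _ fun x y hy => ?_).symm.trans ?_
      · have := dfun_supp (R := R) _ (x ⟨l, h⟩) y (by simpa using hy)
        have := dg_update x ⟨l, h⟩ y
        rw [if_neg (by omega)]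
      · have : diag (fun _ : (∀ i, ℕ × G i) => (0 : R)) = 0 := by
          refine end_ext fun x => ?_
          rw [diag_single]; simp
        rw [this, zero_mul]
    · rw [opn_ge _ _ _ h, zero_mul]
  rw [this, mul_zero]

/-- linear version of the differential -/
noncomputable def dl (n : ℕ) : (ExpDeg k (n + 1) →₀ MonoidAlgebra R (∀ i, G i)) →ₗ[R]
    (ExpDeg k n →₀ MonoidAlgebra R (∀ i, G i)) :=
  ret R G n ∘ₗ (opd R c lg h1 h2 h3 h4).D k ∘ₗ inc R G (n + 1)

lemma inc_dl (n : ℕ) (v : ExpDeg k (n + 1) →₀ MonoidAlgebra R (∀ i, G i)) :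
    inc R G n (dl c lg h1 h2 h3 h4 n v) = (opd R c lg h1 h2 h3 h4).D k (inc R G (n + 1) v) := by
  have := LinearMap.congr_fun (pr_D (R := R) c lg h1 h2 h3 h4 n) (inc R G (n + 1) v)
  rw [Module.End.mul_apply, Module.End.mul_apply, pr_inc] at this
  rw [← this, ← inc_ret]
  rfl

lemma inc_inj (n : ℕ) : Function.Injective (inc R G n) :=
  Function.LeftInverse.injective (ret_inc n)

/-- differential -/
noncomputable def dd (n : ℕ) :
    Rep.free R (∀ i, G i) (ExpDeg k (n + 1)) ⟶ Rep.free R (∀ i, G i) (ExpDeg k n) :=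
  Rep.ofHom ⟨dl c lg h1 h2 h3 h4 n, fun g => by
    refine LinearMap.ext fun v => inc_inj n ?_
    rw [LinearMap.comp_apply, LinearMap.comp_apply, inc_dl, inc_act, inc_act, inc_dl]
    exact (LinearMap.congr_fun (act_D c lg h1 h2 h3 h4 g).eq (inc R G (n + 1) v)).symm⟩

variable (R G) in
/-- augmentation morphism -/
noncomputable def ee : Rep.free R (∀ i, G i) (ExpDeg k 0) ⟶ Rep.trivial R (∀ i, G i) R :=
  Rep.ofHom ⟨aug ∘ₗ inc R G 0, fun g => by
    refine LinearMap.ext fun v => ?_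
    rw [LinearMap.comp_apply, LinearMap.comp_apply, inc_act, aug_act]
    rfl⟩

lemma dd_apply (n : ℕ) (v : ExpDeg k (n + 1) →₀ MonoidAlgebra R (∀ i, G i)) :
    (dd c lg h1 h2 h3 h4 n).hom v = dl c lg h1 h2 h3 h4 n v := rfl

lemma ee_apply (v : ExpDeg k 0 →₀ MonoidAlgebra R (∀ i, G i)) :
    (ee R G).hom v = aug (inc R G 0 v) := rfl

lemma exists_dl (n : ℕ) (x : ExpDeg k n →₀ MonoidAlgebra R (∀ i, G i))
    (hx : (opd R c lg h1 h2 h3 h4).D k (inc R G n x) = 0) (ha : aug (inc R G n x) = 0) :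
    ∃ y, dl c lg h1 h2 h3 h4 n y = x := by
  refine ⟨ret R G (n + 1) ((opd R c lg h1 h2 h3 h4).H k (inc R G n x)), inc_inj n ?_⟩
  have := LinearMap.congr_fun (pr_H (R := R) c lg h1 h2 h3 h4 n) (inc R G n x)
  rw [Module.End.mul_apply, Module.End.mul_apply, pr_inc] at this
  rw [inc_dl, inc_ret, this]
  exact exact_D c lg h1 h2 h3 h4 _ hx ha

lemma dd_dd (n : ℕ) : dd (R := R) c lg h1 h2 h3 h4 (n + 1) ≫ dd c lg h1 h2 h3 h4 n = 0 := by
  refine ConcreteCategory.hom_ext _ _ fun v => ?_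
  change dl c lg h1 h2 h3 h4 n (dl c lg h1 h2 h3 h4 (n + 1) v) = 0
  apply inc_inj
  rw [inc_dl, inc_dl, map_zero]
  exact LinearMap.congr_fun ((opd R c lg h1 h2 h3 h4).D_sq k) _

lemma dd_ee : dd (R := R) c lg h1 h2 h3 h4 0 ≫ ee R G = 0 := by
  refine ConcreteCategory.hom_ext _ _ fun v => ?_
  change aug (inc R G 0 (dl c lg h1 h2 h3 h4 0 v)) = 0
  rw [inc_dl, aug_D]

lemma dd_min (B : Type) [AddCommGroup B] [Module R B]
    (hB : ∀ i (b : B), (Fintype.card (G i) : R) • b = 0) (n : ℕ)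
    (f : Rep.free R (∀ i, G i) (ExpDeg k n) ⟶ Rep.trivial R (∀ i, G i) B) :
    dd (R := R) c lg h1 h2 h3 h4 n ≫ f = 0 := by
  refine ConcreteCategory.hom_ext _ _ fun v => ?_
  let f' : (ExpDeg k n →₀ MonoidAlgebra R (∀ i, G i)) →ₗ[R] B := f.hom.toLinearMap
  have hf' : ∀ g v, f' (Representation.free R (∀ i, G i) (ExpDeg k n) g v) = f' v := fun g v =>
    LinearMap.congr_fun (f.hom.isIntertwining' g) v
  change f' (ret R G n ((opd R c lg h1 h2 h3 h4).D k (inc R G (n + 1) v))) = 0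
  refine inv_D c lg h1 h2 h3 h4 (f' ∘ₗ ret R G n) (fun g w => ?_) hB _
  rw [LinearMap.comp_apply, LinearMap.comp_apply, ret_act, hf']

lemma main_aux [∀ i, IsCyclic (G i)] (B : Type) [AddCommGroup B] [Module R B]
    (hB : ∀ i (b : B), (Fintype.card (G i) : R) • b = 0) (q : ℕ) :
    Nonempty (groupCohomology (Rep.trivial R (∀ i, G i) B) q ≃ₗ[R] (ExpDeg k q → B)) := by
  choose c hc using fun i => IsCyclic.exists_generator (α := G i)
  choose lg h1 h2 h3 h4 using fun i => exists_log (c i) (hc i)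
  refine cohomology_of_minimal (R := R) (G := ∀ i, G i) (fun n => ExpDeg k n)
    (fun n => dd (R := R) c lg h1 h2 h3 h4 n) (ee R G) (dd_dd c lg h1 h2 h3 h4)
    (dd_ee c lg h1 h2 h3 h4) ?_ ?_ ?_
    (Rep.trivial R (∀ i, G i) B) (dd_min c lg h1 h2 h3 h4 B hB) q
  · intro n x hx
    rw [dd_apply] at hx
    refine exists_dl c lg h1 h2 h3 h4 (n + 1) x ?_ (aug_inc _ _)
    rw [← inc_dl, hx, map_zero]
  · intro x hx
    refine exists_dl c lg h1 h2 h3 h4 0 x ?_ hx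
    rw [← pr_inc]
    exact LinearMap.congr_fun (D_pr_zero c lg h1 h2 h3 h4) _
  · intro r
    refine ⟨Finsupp.single ⟨0, by simp⟩ (MonoidAlgebra.single 1 r), ?_⟩
    rw [ee_apply, inc_single, aug_single]
    exact if_pos (fun _ => rfl)

lemma finite_expDeg (k q : ℕ) : Finite {a : Fin k → ℕ // ∑ i, a i = q} := by
  have hle : ∀ (a : {a : Fin k → ℕ // ∑ i, a i = q}) i, a.1 i < q + 1 := fun a i => by
    have := Finset.single_le_sum (f := a.1) (fun _ _ => Nat.zero_le _) (Finset.mem_univ i)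
    have := a.2
    omega
  refine Finite.of_injective
    (fun a i => (⟨a.1 i, hle a i⟩ : Fin (q + 1))) fun a b h => Subtype.ext (funext fun i => ?_)
  exact congrArg Fin.val (congrFun h i)

end EndPart

/-- for `G = G_1 × ··· × G_k` a product of finite cyclic groups of orders
`n_1,...,n_k`, `A` a free `𝒪`-module with trivial `G`-action and `M ∈ 𝒪` a common divisor
of all `n_i`, the cohomology `H^q(G, A/MA)` is a free `A/MA`-module of rank equal to the
number of monomials `g_1^{a_1}···g_k^{a_k}` of total degree `q`. -/
theorem stmt7 (k : ℕ) (G : Fin k → Type) [∀ i, Group (G i)] [∀ i, Fintype (G i)]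
    [∀ i, IsCyclic (G i)] (𝒪 : Type) [CommRing 𝒪]
    (A : Type) [AddCommGroup A] [Module 𝒪 A] [Module.Free 𝒪 A]
    (M : 𝒪) (hM : ∀ i, M ∣ ((Fintype.card (G i) : ℕ) : 𝒪)) (q : ℕ) :
    Nonempty
      ((groupCohomology
          (Rep.trivial 𝒪 (∀ i, G i) (A ⧸ (Ideal.span {M} • (⊤ : Submodule 𝒪 A)))) q)
        ≃ₗ[𝒪] (Fin (Nat.card {a : Fin k → ℕ // ∑ i, a i = q})
            → A ⧸ (Ideal.span {M} • (⊤ : Submodule 𝒪 A)))) := by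
  obtain ⟨e⟩ := main_aux (R := 𝒪) (G := G)
    (A ⧸ (Ideal.span {M} • (⊤ : Submodule 𝒪 A))) (fun i b => by
      obtain ⟨a, rfl⟩ := Submodule.Quotient.mk_surjective _ b
      obtain ⟨m, hm⟩ := hM i
      rw [← Submodule.Quotient.mk_smul, Submodule.Quotient.mk_eq_zero, hm]
      exact Submodule.smul_mem_smul (Ideal.mul_mem_right _ _ (Ideal.mem_span_singleton_self M))
        Submodule.mem_top) q
  have := finite_expDeg k q
  exact ⟨e.trans (LinearEquiv.funCongrLeft 𝒪 _ (Finite.equivFin _).symm)⟩
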